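/- arXiv:1909.02415 — 6 statements merged into one kernel-verified Lean document; each statement's English description precedes it below -/
import Mathlib

section
/- Let B and M be positive integers such that there exists a positive integer A with M = A + B or M = A · B. Then the set of positive integers x satisfying x + B = M or x · B = M has exactly one element if and only if B = M, or B does not divide M, or (M = 4 and B = 2). -/
theorem two_person_first_round_yes (B M : ℕ) (hB : 0 < B) (hM : 0 < M)
    (hex : ∃ A : ℕ, 0 < A ∧ (M = A + B ∨ M = A * B)) :
    (∃! x : ℕ, 0 < x ∧ (x + B = M ∨ x * B = M)) ↔
      B = M ∨ ¬ B ∣ M ∨ (M = 4 ∧ B = 2) := by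
  constructor
  · intro h
    by_contra hc
    push Not at hc
    obtain ⟨hne, ⟨k, hk⟩, h42⟩ := hc
    have hk2 : 2 ≤ k := by
      by_contra hlt
      have : k = 0 ∨ k = 1 := by omega
      rcases this with rfl | rfl <;> simp at hk <;> omega
    obtain ⟨j, rfl⟩ : ∃ j, k = j + 2 := ⟨k - 2, by omega⟩
    have e : j + 2 = B * (j + 1) := by
      refine h.unique ⟨by omega, Or.inr ?_⟩ ⟨by positivity, Or.inl ?_⟩
      · rw [hk]; ring
      · rw [hk]; ring
    have hB1 : B ≠ 1 := by
      rintro rfl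
      omega
    have hB2 : B = 2 := by
      by_contra h3
      have : 3 ≤ B := by omega
      nlinarith
    subst hB2
    have : j = 0 := by omega
    subst this
    exact h42 (by omega) rfl
  · rintro (rfl | hd | ⟨rfl, rfl⟩)
    · refine ⟨1, ⟨one_pos, Or.inr (one_mul B)⟩, ?_⟩
      rintro y ⟨hy, h | h⟩
      · omega
      · exact Nat.eq_of_mul_eq_mul_right hB (by omega)
    · obtain ⟨A, hA, h | h⟩ := hex
      · refine ⟨A, ⟨hA, Or.inl h.symm⟩, ?_⟩
        rintro y ⟨hy, h' | h'⟩
        · omega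
        · exact absurd ⟨y, by rw [← h', mul_comm]⟩ hd
      · exact absurd ⟨A, by rw [h, mul_comm]⟩ hd
    · refine ⟨2, by norm_num, ?_⟩
      rintro y ⟨hy, h | h⟩ <;> omega
end

section
/- Let p be a prime, n ≥ 1, and let b_1, ..., b_n be positive integers such that there exists a positive integer A with A + (b_1 + ... + b_n) = p or A · (b_1 ⋯ b_n) = p. Then the set of positive integers x satisfying x + (b_1 + ... + b_n) = p or x · (b_1 ⋯ b_n) = p has at least two elements if and only if b_i = 1 for all i and n < p. (A sage fails to know their number in the first round of the prime sum-or-product game exactly when they see all ones and the number of players is at most p.) -/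
theorem prime_game_no_iff_all_ones (p : ℕ) (hp : p.Prime) (n : ℕ) (hn : 1 ≤ n)
    (b : Fin n → ℕ) (hb : ∀ i, 0 < b i)
    (hex : ∃ A : ℕ, 0 < A ∧ (A + ∑ i, b i = p ∨ A * ∏ i, b i = p)) :
    (∃ x y : ℕ, x ≠ y ∧
        (0 < x ∧ (x + ∑ i, b i = p ∨ x * ∏ i, b i = p)) ∧
        (0 < y ∧ (y + ∑ i, b i = p ∨ y * ∏ i, b i = p))) ↔
      (∀ i, b i = 1) ∧ n < p := by
  constructor
  · have hP : 0 < ∏ i, b i := Finset.prod_pos fun i _ => hb i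
    have key : ∀ x y : ℕ, 0 < x → x + ∑ i, b i = p → y * ∏ i, b i = p →
        (∀ i, b i = 1) ∧ n < p := by
      intro x y hx h1 h2
      have hd : ∏ i, b i ∣ p := ⟨y, by rw [← h2, mul_comm]⟩
      rcases (Nat.dvd_prime hp).1 hd with h | h
      · have hall : ∀ i, b i = 1 := fun i =>
          Nat.dvd_one.1 (h ▸ Finset.dvd_prod_of_mem b (Finset.mem_univ i))
        refine ⟨hall, ?_⟩
        have hs : ∑ i, b i = n := by simp [hall]
        omega
      · exfalso
        have hpd : p ∣ ∏ i, b i := h ▸ dvd_rfl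
        obtain ⟨i, _, hi⟩ := (hp.prime.dvd_finset_prod_iff b).1 hpd
        have h3 := Nat.le_of_dvd (hb i) hi
        have h4 : b i ≤ ∑ i, b i :=
          Finset.single_le_sum (fun j _ => Nat.zero_le (b j)) (Finset.mem_univ i)
        omega
    rintro ⟨x, y, hxy, ⟨hx, h1 | h1⟩, ⟨hy, h2 | h2⟩⟩
    · omega
    · exact key x y hx h1 h2
    · exact key y x hy h2 h1
    · exact absurd (Nat.eq_of_mul_eq_mul_right hP (h1.trans h2.symm)) hxy
  · rintro ⟨hall, hlt⟩
    have hs : ∑ i, b i = n := by simp [hall]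
    have hq : ∏ i, b i = 1 := by simp [hall]
    rw [hs, hq]
    exact ⟨p - n, p, by omega, ⟨by omega, Or.inl (by omega)⟩, ⟨by omega, Or.inr (by omega)⟩⟩
end

section
/- Let a, b, c be positive integers with a + b + c = 35 or a · b · c = 35. Suppose that for each of the three positions, the set of positive integers x satisfying x + (sum of the other two numbers) = 35 or x · (product of the other two numbers) = 35 has at least two elements. Then {a, b, c} = {1, 5, 7} as a multiset. (In the three-person sum-or-product game with announced number 35, if everyone says NO in the first round then the numbers must be 1, 5 and 7.) -/
theorem aux35 (b c : ℕ) (hb : 0 < b) (hc : 0 < c)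
    (h : ∃ x y : ℕ, x ≠ y ∧
        (0 < x ∧ (x + (b + c) = 35 ∨ x * (b * c) = 35)) ∧
        (0 < y ∧ (y + (b + c) = 35 ∨ y * (b * c) = 35))) :
    b * c ∣ 35 ∧ b + c < 35 := by
  obtain ⟨x, y, hne, ⟨hx, h1⟩, hy, h2⟩ := h
  rcases h1 with h1 | h1 <;> rcases h2 with h2 | h2
  · omega
  · exact ⟨⟨y, by rw [← h2, mul_comm]⟩, by omega⟩
  · exact ⟨⟨x, by rw [← h1, mul_comm]⟩, by omega⟩
  · exact absurd (Nat.eq_of_mul_eq_mul_right (Nat.mul_pos hb hc) (h1.trans h2.symm)) hne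

theorem div35 (a : ℕ) (h : a ∣ 35) : a = 1 ∨ a = 5 ∨ a = 7 ∨ a = 35 := by
  have h1 : a ∈ Nat.divisors 35 := by simp [h]
  have h2 : Nat.divisors 35 = {1, 5, 7, 35} := by decide
  simpa [h2] using h1

theorem everyone_says_no_35 (a b c : ℕ) (ha : 0 < a) (hb : 0 < b) (hc : 0 < c)
    (h : a + b + c = 35 ∨ a * b * c = 35)
    (hA : ∃ x y : ℕ, x ≠ y ∧
        (0 < x ∧ (x + (b + c) = 35 ∨ x * (b * c) = 35)) ∧
        (0 < y ∧ (y + (b + c) = 35 ∨ y * (b * c) = 35)))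
    (hB : ∃ x y : ℕ, x ≠ y ∧
        (0 < x ∧ (x + (a + c) = 35 ∨ x * (a * c) = 35)) ∧
        (0 < y ∧ (y + (a + c) = 35 ∨ y * (a * c) = 35)))
    (hC : ∃ x y : ℕ, x ≠ y ∧
        (0 < x ∧ (x + (a + b) = 35 ∨ x * (a * b) = 35)) ∧
        (0 < y ∧ (y + (a + b) = 35 ∨ y * (a * b) = 35))) :
    ({a, b, c} : Multiset ℕ) = {1, 5, 7} := by
  obtain ⟨a1, a2⟩ := aux35 b c hb hc hA
  obtain ⟨b1, b2⟩ := aux35 a c ha hc hB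
  obtain ⟨c1, c2⟩ := aux35 a b ha hb hC
  clear hA hB hC
  have ka := div35 a (dvd_of_mul_right_dvd c1)
  have kb := div35 b (dvd_of_mul_left_dvd c1)
  have kc := div35 c (dvd_of_mul_left_dvd a1)
  rcases ka with rfl | rfl | rfl | rfl <;> rcases kb with rfl | rfl | rfl | rfl <;>
    rcases kc with rfl | rfl | rfl | rfl <;> first | omega | decide
end

section
/- Let a_1, a_2, a_3, a_4 be positive integers with a_1 + a_2 + a_3 + a_4 = 10 or a_1 · a_2 · a_3 · a_4 = 10. Suppose that exactly two of the four indices j have the property that the set of positive integers x satisfying x + (sum of the other three numbers) = 10 or x · (product of the other three numbers) = 10 has at least two elements. Then each of those two indices j satisfies a_j = 2, and the multiset {a_1, a_2, a_3, a_4} equals {1, 2, 2, 5}. (In the four-person sum-or-product game with announced number 10, if exactly two sages say NO in the first round, then those two sages each have the number 2.) -/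
def NoP (s p : ℕ) : Prop := s < 10 ∧ 10 % p = 0 ∧ (10 - s) * p ≠ 10

instance (s p : ℕ) : Decidable (NoP s p) := by unfold NoP; infer_instance

theorem noP_iff (s p : ℕ) (hp : 0 < p) :
    (∃ x y : ℕ, x ≠ y ∧ (0 < x ∧ (x + s = 10 ∨ x * p = 10)) ∧
      (0 < y ∧ (y + s = 10 ∨ y * p = 10))) ↔ NoP s p := by
  unfold NoP
  constructor
  · rintro ⟨x, y, hxy, ⟨hx, h1⟩, hy, h2⟩
    have key : ∀ u v : ℕ, u ≠ v → 0 < u → u + s = 10 → v * p = 10 →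
        s < 10 ∧ 10 % p = 0 ∧ (10 - s) * p ≠ 10 := by
      intro u v huv hu h3 h4
      refine ⟨by omega, ?_, ?_⟩
      · rw [← h4]; exact Nat.mul_mod_left v p
      · have : 10 - s = u := by omega
        rw [this, ← h4]
        intro h5
        exact huv (Nat.eq_of_mul_eq_mul_right hp h5)
    rcases h1 with h1 | h1 <;> rcases h2 with h2 | h2
    · omega
    · exact key x y hxy hx h1 h2
    · exact key y x hxy.symm hy h2 h1
    · exact absurd (Nat.eq_of_mul_eq_mul_right hp (h1.trans h2.symm)) hxy
  · rintro ⟨h1, h2, h3⟩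
    obtain ⟨k, hk⟩ := Nat.dvd_of_mod_eq_zero h2
    rw [mul_comm] at hk
    refine ⟨10 - s, k, ?_, ⟨by omega, Or.inl (by omega)⟩, ?_, Or.inr hk.symm⟩
    · rintro rfl
      exact h3 hk.symm
    · rcases Nat.eq_zero_or_pos k with rfl | h
      · simp at hk
      · exact h

def Chk (a b c d : ℕ) : Prop :=
    0 < a → 0 < b → 0 < c → 0 < d →
    (a + b + c + d = 10 ∨ a * b * c * d = 10) →
    (if NoP (b + c + d) (b * c * d) then 1 else 0) +
    (if NoP (a + c + d) (a * c * d) then 1 else 0) +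
    (if NoP (a + b + d) (a * b * d) then 1 else 0) +
    (if NoP (a + b + c) (a * b * c) then 1 else 0) = 2 →
    ((NoP (b + c + d) (b * c * d) → a = 2) ∧
    (NoP (a + c + d) (a * c * d) → b = 2) ∧
    (NoP (a + b + d) (a * b * d) → c = 2) ∧
    (NoP (a + b + c) (a * b * c) → d = 2)) ∧
    ({a, b, c, d} : Multiset ℕ) = {1, 2, 2, 5}

set_option synthInstance.maxHeartbeats 400000 in
set_option synthInstance.maxSize 4000 in
instance (a b c d : ℕ) : Decidable (Chk a b c d) := by unfold Chk; infer_instance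

theorem finite_check : ∀ a < 11, ∀ b < 11, ∀ c < 11, ∀ d < 11, Chk a b c d := by
  decide +kernel

theorem two_say_no_10 (a : Fin 4 → ℕ) (ha : ∀ i, 0 < a i)
    (h : ∑ i, a i = 10 ∨ ∏ i, a i = 10)
    (hno : {j : Fin 4 | ∃ x y : ℕ, x ≠ y ∧
        (0 < x ∧ (x + ∑ i ∈ Finset.univ.erase j, a i = 10 ∨
                  x * ∏ i ∈ Finset.univ.erase j, a i = 10)) ∧
        (0 < y ∧ (y + ∑ i ∈ Finset.univ.erase j, a i = 10 ∨
                  y * ∏ i ∈ Finset.univ.erase j, a i = 10))}.ncard = 2) :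
    (∀ j ∈ {j : Fin 4 | ∃ x y : ℕ, x ≠ y ∧
        (0 < x ∧ (x + ∑ i ∈ Finset.univ.erase j, a i = 10 ∨
                  x * ∏ i ∈ Finset.univ.erase j, a i = 10)) ∧
        (0 < y ∧ (y + ∑ i ∈ Finset.univ.erase j, a i = 10 ∨
                  y * ∏ i ∈ Finset.univ.erase j, a i = 10))}, a j = 2) ∧
      ({a 0, a 1, a 2, a 3} : Multiset ℕ) = {1, 2, 2, 5} := by
  have hset : {j : Fin 4 | ∃ x y : ℕ, x ≠ y ∧
        (0 < x ∧ (x + ∑ i ∈ Finset.univ.erase j, a i = 10 ∨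
                  x * ∏ i ∈ Finset.univ.erase j, a i = 10)) ∧
        (0 < y ∧ (y + ∑ i ∈ Finset.univ.erase j, a i = 10 ∨
                  y * ∏ i ∈ Finset.univ.erase j, a i = 10))} =
      ((Finset.univ.filter fun j : Fin 4 =>
        NoP (∑ i ∈ Finset.univ.erase j, a i) (∏ i ∈ Finset.univ.erase j, a i) : Finset (Fin 4)) :
        Set (Fin 4)) := by
    ext j
    simp only [Set.mem_ofPred_eq, Finset.coe_filter, Finset.mem_univ, true_and]
    exact noP_iff _ _ (Finset.prod_pos fun i _ => ha i)
  rw [hset] at hno ⊢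
  rw [Set.ncard_coe_finset, Finset.card_filter] at hno
  have e0 : (Finset.univ.erase (0 : Fin 4)) = {1, 2, 3} := by decide
  have e1 : (Finset.univ.erase (1 : Fin 4)) = {0, 2, 3} := by decide
  have e2 : (Finset.univ.erase (2 : Fin 4)) = {0, 1, 3} := by decide
  have e3 : (Finset.univ.erase (3 : Fin 4)) = {0, 1, 2} := by decide
  have s3 : ∀ i j k : Fin 4, i ≠ j → i ≠ k → j ≠ k →
      ∑ l ∈ ({i, j, k} : Finset (Fin 4)), a l = a i + a j + a k := by
    intro i j k h1 h2 h3
    rw [Finset.sum_insert (by simp [h1, h2]), Finset.sum_pair h3, add_assoc]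
  have p3 : ∀ i j k : Fin 4, i ≠ j → i ≠ k → j ≠ k →
      ∏ l ∈ ({i, j, k} : Finset (Fin 4)), a l = a i * a j * a k := by
    intro i j k h1 h2 h3
    rw [Finset.prod_insert (by simp [h1, h2]), Finset.prod_pair h3, mul_assoc]
  have hb : ∀ i, a i < 11 := by
    intro i
    rcases h with h | h
    · have := Finset.single_le_sum (f := a) (fun i _ => Nat.zero_le _) (Finset.mem_univ i)
      omega
    · have := Nat.le_of_dvd (by omega) (h ▸ Finset.dvd_prod_of_mem a (Finset.mem_univ i))
      omega
  rw [Fin.sum_univ_four, Fin.prod_univ_four] at h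
  rw [Fin.sum_univ_four, e0, e1, e2, e3,
    s3 1 2 3 (by decide) (by decide) (by decide), s3 0 2 3 (by decide) (by decide) (by decide),
    s3 0 1 3 (by decide) (by decide) (by decide), s3 0 1 2 (by decide) (by decide) (by decide),
    p3 1 2 3 (by decide) (by decide) (by decide), p3 0 2 3 (by decide) (by decide) (by decide),
    p3 0 1 3 (by decide) (by decide) (by decide), p3 0 1 2 (by decide) (by decide) (by decide)]
    at hno
  obtain ⟨⟨q0, q1, q2, q3⟩, hm⟩ := finite_check (a 0) (hb 0) (a 1) (hb 1) (a 2) (hb 2) (a 3) (hb 3)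
    (ha 0) (ha 1) (ha 2) (ha 3) h hno
  refine ⟨?_, hm⟩
  intro j hj
  simp only [Finset.coe_filter, Finset.mem_univ, true_and, Set.mem_ofPred_eq] at hj
  fin_cases j
  · refine q0 ?_
    rw [← s3 1 2 3 (by decide) (by decide) (by decide),
      ← p3 1 2 3 (by decide) (by decide) (by decide), ← e0]
    exact hj
  · refine q1 ?_
    rw [← s3 0 2 3 (by decide) (by decide) (by decide),
      ← p3 0 2 3 (by decide) (by decide) (by decide), ← e1]
    exact hj
  · refine q2 ?_
    rw [← s3 0 1 3 (by decide) (by decide) (by decide),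
      ← p3 0 1 3 (by decide) (by decide) (by decide), ← e2]
    exact hj
  · refine q3 ?_
    rw [← s3 0 1 2 (by decide) (by decide) (by decide),
      ← p3 0 1 2 (by decide) (by decide) (by decide), ← e3]
    exact hj
end

section
/- Let b be a positive integer. The set of positive integers x for which there exist positive integers c_1, ..., c_8 with x + b + c_1 + ... + c_8 ∈ {30, 31, 32} has exactly one element if and only if b = 23, and in that case the unique element is 1. (In the line of ten near-sighted sages whose numbers are positive integers summing to 30, 31 or 32, the first sage knows his number immediately exactly when his neighbor has 23, in which case everyone has 1 except the neighbor.) -/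
theorem key_cand (b x : ℕ) : (0 < x ∧ ∃ c : Fin 8 → ℕ, (∀ i, 0 < c i) ∧
        (x + b + ∑ i, c i = 30 ∨ x + b + ∑ i, c i = 31 ∨ x + b + ∑ i, c i = 32)) ↔
      (0 < x ∧ x + b ≤ 24) := by
  constructor
  · rintro ⟨hx, c, hc, h⟩
    refine ⟨hx, ?_⟩
    simp only [Fin.sum_univ_eight] at h
    have h0 := hc 0
    have h1 := hc 1
    have h2 := hc 2
    have h3 := hc 3
    have h4 := hc 4
    have h5 := hc 5
    have h6 := hc 6
    have h7 := hc 7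
    omega
  · rintro ⟨hx, h⟩
    refine ⟨hx, fun i => if i = 0 then 25 - (x + b) else 1, ?_, ?_⟩
    · intro i
      dsimp only
      split_ifs <;> omega
    · simp [Fin.sum_univ_eight]
      omega

theorem ten_nearsighted_line_first_knows (b : ℕ) (hb : 0 < b) :
    ((∃! x : ℕ, 0 < x ∧ ∃ c : Fin 8 → ℕ, (∀ i, 0 < c i) ∧
        (x + b + ∑ i, c i = 30 ∨ x + b + ∑ i, c i = 31 ∨ x + b + ∑ i, c i = 32)) ↔
      b = 23) ∧
    (b = 23 →
      {x : ℕ | 0 < x ∧ ∃ c : Fin 8 → ℕ, (∀ i, 0 < c i) ∧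
        (x + b + ∑ i, c i = 30 ∨ x + b + ∑ i, c i = 31 ∨ x + b + ∑ i, c i = 32)} = {1}) := by
  simp only [key_cand]
  refine ⟨⟨?_, ?_⟩, ?_⟩
  · rintro ⟨x, ⟨hx, hxb⟩, hu⟩
    by_contra hne
    have e1 := hu 1 ⟨by omega, by omega⟩
    have e2 := hu 2 ⟨by omega, by omega⟩
    omega
  · rintro rfl
    exact ⟨1, ⟨by omega, by omega⟩, fun y hy => by omega⟩
  · rintro rfl
    ext x
    simp only [Set.mem_setOf_eq, Set.mem_singleton_iff]
    omega
end

section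
/- Let p and q be distinct primes, n ≥ 1, and let b_1, ..., b_n be positive integers. There exists a positive integer x with x · (b_1 ⋯ b_n) = p·q and x + (b_1 + ... + b_n) = p·q if and only if n = p·q − p − q + 1 and the multiset {b_1, ..., b_n} is one of: {p} together with n−1 ones, {q} together with n−1 ones, or {p, q} together with n−2 ones. (For a semiprime announced number, the 'whatever' case occurs exactly when a sage sees only ones together with p, with q, or with both p and q, and the number of players equals pq − p − q + 2.) -/
theorem aux_one (s : Multiset ℕ) (h : s.prod = 1) : s = Multiset.replicate s.card 1 := by
  rw [Multiset.eq_replicate]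
  refine ⟨rfl, fun a ha => ?_⟩
  have := Multiset.dvd_prod ha
  rw [h] at this
  exact Nat.dvd_one.mp this

theorem aux_prime (s : Multiset ℕ) (p : ℕ) (hp : p.Prime) (h : s.prod = p) :
    ∃ k, s = p ::ₘ Multiset.replicate k 1 := by
  obtain ⟨a, ha, hpa⟩ := (Nat.Prime.prime hp).exists_mem_multiset_dvd (s := s) (by rw [h])
  have had : a ∣ p := h ▸ Multiset.dvd_prod ha
  have hap : a = p := Nat.dvd_antisymm had hpa
  subst hap
  obtain ⟨t, rfl⟩ := Multiset.exists_cons_of_mem ha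
  rw [Multiset.prod_cons] at h
  have ht : t.prod = 1 := Nat.eq_of_mul_eq_mul_left hp.pos (by simpa using h)
  exact ⟨t.card, by rw [← aux_one t ht]⟩

theorem aux_semi (s : Multiset ℕ) (p q : ℕ) (hp : p.Prime) (hq : q.Prime) (h : s.prod = p * q) :
    (∃ k, s = (p * q) ::ₘ Multiset.replicate k 1) ∨
    ∃ k, s = p ::ₘ q ::ₘ Multiset.replicate k 1 := by
  obtain ⟨a, ha, c, rfl⟩ := (Nat.Prime.prime hp).exists_mem_multiset_dvd (s := s)
    (by rw [h]; exact dvd_mul_right _ _)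
  obtain ⟨t, rfl⟩ := Multiset.exists_cons_of_mem ha
  rw [Multiset.prod_cons, mul_assoc] at h
  have ht : c * t.prod = q := Nat.eq_of_mul_eq_mul_left hp.pos h
  rcases (Nat.dvd_prime hq).mp ⟨_, ht.symm⟩ with rfl | rfl
  · right
    obtain ⟨k, rfl⟩ := aux_prime t q hq (by simpa using ht)
    exact ⟨k, by simp⟩
  · left
    have ht : t.prod = 1 := Nat.eq_of_mul_eq_mul_left hq.pos (by simpa using ht)
    exact ⟨t.card, by rw [← aux_one t ht]⟩

theorem semiprime_whatever_iff (p q : ℕ) (hp : p.Prime) (hq : q.Prime)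
    (hpq : p ≠ q) (n : ℕ) (hn : 1 ≤ n) (b : Fin n → ℕ) (hb : ∀ i, 0 < b i) :
    (∃ x : ℕ, 0 < x ∧ x * ∏ i, b i = p * q ∧ x + ∑ i, b i = p * q) ↔
      n = p * q - p - q + 1 ∧
        ((↑(List.ofFn b) : Multiset ℕ) = {p} + Multiset.replicate (n - 1) 1 ∨
         (↑(List.ofFn b) : Multiset ℕ) = {q} + Multiset.replicate (n - 1) 1 ∨
         (↑(List.ofFn b) : Multiset ℕ) = {p, q} + Multiset.replicate (n - 2) 1) := by
  have hP : ∏ i, b i = (↑(List.ofFn b) : Multiset ℕ).prod := by simp [List.prod_ofFn]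
  have hS : ∑ i, b i = (↑(List.ofFn b) : Multiset ℕ).sum := by simp [List.sum_ofFn]
  have hC : (↑(List.ofFn b) : Multiset ℕ).card = n := by simp
  rw [hP, hS]
  generalize (↑(List.ofFn b) : Multiset ℕ) = s at *
  have h2 := hp.two_le
  have h3 := hq.two_le
  have hbig : p + q + 1 ≤ p * q := by
    rcases lt_or_gt_of_ne hpq with h | h <;> nlinarith
  constructor
  · rintro ⟨x, hx, h1, hsum⟩
    have hx0 : s.prod ∣ p * q := ⟨x, by rw [← h1, mul_comm]⟩
    obtain ⟨u, v, hu, hv, huv⟩ := (Nat.dvd_mul).mp hx0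
    rcases (Nat.dvd_prime hp).mp hu with rfl | rfl <;>
    rcases (Nat.dvd_prime hq).mp hv with rfl | rfl
    · exfalso
      have h1' : s.prod = 1 := by rw [← huv]
      rw [h1'] at h1
      rw [aux_one s h1', hC] at hsum
      simp at hsum
      omega
    · obtain ⟨k, rfl⟩ := aux_prime s v hq (by rw [← huv, one_mul])
      simp at h1 hsum hC
      have : x = p := by rcases h1 with h | h <;> omega
      subst this
      refine ⟨by omega, Or.inr (Or.inl ?_)⟩
      rw [← hC]; simp
    · obtain ⟨k, rfl⟩ := aux_prime s u hp (by rw [← huv, mul_one])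
      simp at h1 hsum hC
      have : x = q := Nat.eq_of_mul_eq_mul_left hp.pos (by rw [← h1, mul_comm])
      subst this
      refine ⟨by omega, Or.inl ?_⟩
      rw [← hC]; simp
    · rw [← huv] at h1
      have : x = 1 := Nat.eq_of_mul_eq_mul_right (by positivity : 0 < u * v) (by rw [h1, one_mul])
      subst this
      rcases aux_semi s u v hp hq huv.symm with ⟨k, rfl⟩ | ⟨k, rfl⟩
      · simp at hsum
        omega
      · simp at hsum hC
        refine ⟨by omega, Or.inr (Or.inr ?_)⟩
        rw [← hC]; simp
  · rintro ⟨hn', h | h | h⟩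
    · refine ⟨q, hq.pos, ?_, ?_⟩
      · simp [h, mul_comm]
      · simp [h]; omega
    · refine ⟨p, hp.pos, ?_, ?_⟩
      · simp [h]
      · simp [h]; omega
    · refine ⟨1, one_pos, ?_, ?_⟩
      · simp [h]
      · simp [h]; omega
end
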